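/- Let F be a pointwise almost periodic decomposition of a compact Hausdorff topological space X, let G be a pointwise almost periodic decomposition of a compact Hausdorff topological space Y, and let p : X → Y be a semi-conjugacy from F to G. Then for every subset A ⊆ X, p(⋃_{x ∈ A} F̂(x)) = ⋃_{y ∈ p(A)} Ĝ(y); in particular p(F̂(x)) = Ĝ(p(x)) for every x ∈ X. -/

import Mathlib

open Set Topology

/-- The class of `x` in the decomposition `F`. -/
def Fhat {X : Type*} [TopologicalSpace X] (F : X → Set X) (x : X) : Set X :=
  {y | closure (F y) = closure (F x)}

/-- In a pointwise almost periodic decomposition, the class of a point is the closure of its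
element. -/
theorem Fhat_eq_closure {X : Type*} [TopologicalSpace X] {F : X → Set X}
    (hmem : ∀ x, x ∈ F x)
    (hpap : ∀ x y, closure (F x) = closure (F y) ∨ Disjoint (closure (F x)) (closure (F y)))
    (x : X) : Fhat F x = closure (F x) := by
  ext y
  have hy : y ∈ closure (F y) := subset_closure (hmem y)
  refine ⟨fun h => ?_, fun h => (hpap y x).resolve_right fun hd => ?_⟩
  · rwa [← show closure (F y) = closure (F x) from h]
  · exact Set.disjoint_left.mp hd hy h

/-- A semi-conjugacy between pointwise almost periodic decompositions of compact
Hausdorff spaces intertwines the `F̂`- and `Ĝ`-saturations of sets; in particular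
it maps classes onto classes. -/
theorem stmt12 {X Y : Type*} [TopologicalSpace X] [CompactSpace X] [T2Space X]
    [TopologicalSpace Y] [CompactSpace Y] [T2Space Y]
    (F : X → Set X) (hFmem : ∀ x, x ∈ F x) (hFpart : ∀ x y, y ∈ F x → F y = F x)
    (G : Y → Set Y) (hGmem : ∀ y, y ∈ G y) (hGpart : ∀ y z, z ∈ G y → G z = G y)
    (hFpap : ∀ x y, closure (F x) = closure (F y) ∨ Disjoint (closure (F x)) (closure (F y)))
    (hGpap : ∀ a b, closure (G a) = closure (G b) ∨ Disjoint (closure (G a)) (closure (G b)))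
    (p : X → Y) (hp : Continuous p) (hps : Function.Surjective p)
    (hsemi : ∀ x, p '' F x = G (p x)) :
    (∀ A : Set X, p '' (⋃ x ∈ A, Fhat F x) = ⋃ y ∈ p '' A, Fhat G y) ∧
      ∀ x : X, p '' Fhat F x = Fhat G (p x) := by
  have key : ∀ x : X, p '' Fhat F x = Fhat G (p x) := fun x => by
    rw [Fhat_eq_closure hFmem hFpap, Fhat_eq_closure hGmem hGpap, ← hsemi,
      hp.isClosedMap.closure_image_eq_of_continuous hp]
  exact ⟨fun A => by simp only [image_iUnion₂, key, biUnion_image], key⟩
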